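/- Let β be a positive even integer and θ ∈ ℝ. Define F(u₁,…,u_β) := ∏_{j=1}^β e^{iθu_j} · u_j^{2/β − 1}(1 − u_j)^{2/β − 1} · ∏_{1≤j<k≤β} |u_k − u_j|^{4/β} on (0,1)^β. Then iθ · ∫_{[0,1]^β} ( Σ_{k=1}^β u_k(1 − u_k) ) F(u) du = −2β · ∫_{[0,1]^β} F(u) du + 4 · ∫_{[0,1]^β} ( Σ_{k=1}^β u_k ) F(u) du, all integrals being absolutely convergent complex-valued integrals. -/

import Mathlib

open MeasureTheory Real Filter Topology

/-- The oscillatory Selberg-type integrand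
`F(u) = ∏_j e^{iθu_j} u_j^{2/β−1}(1−u_j)^{2/β−1} ∏_{j<k} |u_k−u_j|^{4/β}`. -/
noncomputable def selbergF (β : ℕ) (θ : ℝ) (u : Fin β → ℝ) : ℂ :=
  (∏ j : Fin β, Complex.exp (Complex.I * (θ : ℂ) * (u j : ℂ))) *
    (((∏ j : Fin β, u j ^ ((2 : ℝ) / β - 1) * (1 - u j) ^ ((2 : ℝ) / β - 1)) *
        ∏ j : Fin β, ∏ k ∈ Finset.Ioi j, |u k - u j| ^ ((4 : ℝ) / β) : ℝ) : ℂ)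

/-- The unit cube `[0,1]^β`. -/
def unitCube (β : ℕ) : Set (Fin β → ℝ) := Set.univ.pi fun _ : Fin β => Set.Icc (0 : ℝ) 1

/-- The real (non-oscillatory) weight. -/
noncomputable def selW (β : ℕ) (u : Fin β → ℝ) : ℝ :=
  (∏ j : Fin β, u j ^ ((2 : ℝ) / β - 1) * (1 - u j) ^ ((2 : ℝ) / β - 1)) *
        ∏ j : Fin β, ∏ k ∈ Finset.Ioi j, |u k - u j| ^ ((4 : ℝ) / β)

/-- The Moebius flow on `[0,1]`. -/
noncomputable def mob (s x : ℝ) : ℝ := s * x / (1 - x + s * x)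

/-- The single-variable factor of the transformed integrand. -/
noncomputable def gfac (θ s x : ℝ) : ℂ :=
  (((s / (1 - x + s * x) ^ 2) ^ 2 : ℝ) : ℂ) * Complex.exp (Complex.I * θ * (mob s x : ℝ))

/-- The derivative of `gfac` in `s`. -/
noncomputable def gfac' (θ s x : ℝ) : ℂ :=
  ((2 * (s / (1 - x + s * x) ^ 2) * ((1 - x - s * x) / (1 - x + s * x) ^ 3) : ℝ) : ℂ) *
      Complex.exp (Complex.I * θ * (mob s x : ℝ)) +
    (((s / (1 - x + s * x) ^ 2) ^ 2 : ℝ) : ℂ) *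
      (Complex.exp (Complex.I * θ * (mob s x : ℝ)) *
        (Complex.I * θ * ((x * (1 - x) / (1 - x + s * x) ^ 2 : ℝ) : ℂ)))

lemma mob_den_pos {s x : ℝ} (hs : 0 < s) (hx : x ∈ Set.Icc (0 : ℝ) 1) :
    0 < 1 - x + s * x := by
  obtain ⟨h0, h1⟩ := hx
  rcases eq_or_lt_of_le h0 with h | h
  · subst h; norm_num
  · have := mul_pos hs h
    linarith

lemma one_sub_mob {s x : ℝ} (hs : 0 < s) (hx : x ∈ Set.Icc (0 : ℝ) 1) :
    1 - mob s x = (1 - x) / (1 - x + s * x) := by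
  have := (mob_den_pos hs hx).ne'
  unfold mob
  field_simp
  ring

lemma mob_mem {s x : ℝ} (hs : 0 < s) (hx : x ∈ Set.Icc (0 : ℝ) 1) :
    mob s x ∈ Set.Icc (0 : ℝ) 1 := by
  have hD := mob_den_pos hs hx
  constructor
  · exact div_nonneg (mul_nonneg hs.le hx.1) hD.le
  · have h := one_sub_mob hs hx
    have : 0 ≤ (1 - x) / (1 - x + s * x) := div_nonneg (by linarith [hx.2]) hD.le
    linarith

lemma mob_inv {s x : ℝ} (hs : 0 < s) (hx : x ∈ Set.Icc (0 : ℝ) 1) :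
    mob s⁻¹ (mob s x) = x := by
  have hD := (mob_den_pos hs hx).ne'
  have hs' := hs.ne'
  have h1 := one_sub_mob hs hx
  have h2 : 1 - mob s x + s⁻¹ * mob s x = 1 / (1 - x + s * x) := by
    rw [h1]; unfold mob; field_simp; ring
  rw [mob, h2, mob]
  field_simp

lemma hasDerivAt_den_s (s x : ℝ) : HasDerivAt (fun s : ℝ => 1 - x + s * x) x s := by
  simpa using ((hasDerivAt_id s).mul_const x).const_add (1 - x)

lemma hasDerivAt_mob_x {s x : ℝ} (hs : 0 < s) (hx : x ∈ Set.Icc (0 : ℝ) 1) :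
    HasDerivAt (mob s) (s / (1 - x + s * x) ^ 2) x := by
  have hD := (mob_den_pos hs hx).ne'
  have h1 : HasDerivAt (fun x : ℝ => s * x) s x := by
    simpa using (hasDerivAt_id x).const_mul s
  have h2 : HasDerivAt (fun x : ℝ => 1 - x + s * x) (-1 + s) x := by
    simpa using ((hasDerivAt_id x).const_sub 1).fun_add h1
  have h3 := h1.fun_div h2 hD
  refine h3.congr_deriv ?_
  field_simp
  ring

lemma hasDerivAt_mob_s {s x : ℝ} (hs : 0 < s) (hx : x ∈ Set.Icc (0 : ℝ) 1) :
    HasDerivAt (fun s => mob s x) (x * (1 - x) / (1 - x + s * x) ^ 2) s := by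
  have hD := (mob_den_pos hs hx).ne'
  have h1 : HasDerivAt (fun s : ℝ => s * x) x s := by
    simpa using (hasDerivAt_id s).mul_const x
  have h3 := h1.fun_div (hasDerivAt_den_s s x) hD
  refine h3.congr_deriv ?_
  congr 1
  ring

lemma hasDerivAt_gfac (θ : ℝ) {s x : ℝ} (hs : 0 < s) (hx : x ∈ Set.Icc (0 : ℝ) 1) :
    HasDerivAt (fun s => gfac θ s x) (gfac' θ s x) s := by
  have hD := (mob_den_pos hs hx).ne'
  have h1 : HasDerivAt (fun s : ℝ => (s / (1 - x + s * x) ^ 2) ^ 2)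
      (2 * (s / (1 - x + s * x) ^ 2) * ((1 - x - s * x) / (1 - x + s * x) ^ 3)) s := by
    have h := ((hasDerivAt_id s).fun_div ((hasDerivAt_den_s s x).fun_pow 2)
      (pow_ne_zero 2 hD)).fun_pow 2
    refine h.congr_deriv ?_
    have e : 1 - x - s * x = (1 - x + s * x) - 2 * (s * x) := by ring
    rw [e]
    generalize 1 - x + s * x = D at hD
    simp only [id, Nat.cast_ofNat, Nat.add_one_sub_one, pow_one]
    field_simp
  have h2 : HasDerivAt (fun s : ℝ => Complex.exp (Complex.I * θ * (mob s x : ℝ))) _ s :=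
    ((hasDerivAt_mob_s hs hx).ofReal_comp.const_mul (Complex.I * (θ : ℂ))).cexp
  exact h1.ofReal_comp.mul h2

lemma prod_pairs {β : ℕ} (c : Fin β → ℝ) :
    ∏ j : Fin β, ∏ k ∈ Finset.Ioi j, (c k * c j) = ∏ j : Fin β, c j ^ (β - 1) := by
  have h : ∏ j : Fin β, ∏ k ∈ Finset.Ioi j, c k = ∏ k : Fin β, ∏ j ∈ Finset.Iio k, c k :=
    Finset.prod_comm' (by intro x y; simp)
  simp_rw [Finset.prod_mul_distrib]
  rw [h, ← Finset.prod_mul_distrib]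
  refine Finset.prod_congr rfl fun j _ => ?_
  rw [Finset.prod_const, Finset.prod_const, ← pow_add, Fin.card_Ioi, Fin.card_Iio]
  congr 1
  have := j.2
  omega

lemma selW_mob {β : ℕ} (hβ : 0 < β) {s : ℝ} (hs : 0 < s) {u : Fin β → ℝ}
    (hu : u ∈ unitCube β) :
    (∏ j, s / (1 - u j + s * u j) ^ 2) * selW β (fun j => mob s (u j)) =
      (∏ j, (s / (1 - u j + s * u j) ^ 2) ^ 2) * selW β u := by
  have hu' : ∀ j, u j ∈ Set.Icc (0 : ℝ) 1 := fun j => hu j trivial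
  have hD : ∀ j, 0 < 1 - u j + s * u j := fun j => mob_den_pos hs (hu' j)
  have hr : ∀ j, 0 < s / (1 - u j + s * u j) ^ 2 := fun j => div_pos hs (pow_pos (hD j) 2)
  have hβ' : (β : ℝ) ≠ 0 := by exact_mod_cast hβ.ne'
  have hpair : ∀ j k, |mob s (u k) - mob s (u j)| ^ ((4 : ℝ) / β) =
      ((s / (1 - u k + s * u k) ^ 2) ^ ((2 : ℝ) / β) *
        (s / (1 - u j + s * u j) ^ 2) ^ ((2 : ℝ) / β)) * |u k - u j| ^ ((4 : ℝ) / β) := by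
    intro j k
    have e1 : mob s (u k) - mob s (u j) =
        (s / ((1 - u k + s * u k) * (1 - u j + s * u j))) * (u k - u j) := by
      have h1 := (hD j).ne'
      have h2 := (hD k).ne'
      unfold mob
      field_simp
      ring
    have hp : 0 < s / ((1 - u k + s * u k) * (1 - u j + s * u j)) :=
      div_pos hs (mul_pos (hD k) (hD j))
    rw [e1, abs_mul, abs_of_pos hp, Real.mul_rpow hp.le (abs_nonneg _),
      ← Real.mul_rpow (hr k).le (hr j).le]
    congr 1
    have e2 : s / (1 - u k + s * u k) ^ 2 * (s / (1 - u j + s * u j) ^ 2) =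
        (s / ((1 - u k + s * u k) * (1 - u j + s * u j))) ^ (2 : ℝ) := by
      rw [Real.rpow_two]
      have h1 := (hD j).ne'
      have h2 := (hD k).ne'
      field_simp
    rw [e2, ← Real.rpow_mul hp.le]
    congr 1
    ring
  have hone : ∀ j, mob s (u j) ^ ((2 : ℝ) / β - 1) * (1 - mob s (u j)) ^ ((2 : ℝ) / β - 1) =
      (s / (1 - u j + s * u j) ^ 2) ^ ((2 : ℝ) / β - 1) *
        (u j ^ ((2 : ℝ) / β - 1) * (1 - u j) ^ ((2 : ℝ) / β - 1)) := by
    intro j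
    have h0 := (hu' j).1
    have h1 : 0 ≤ 1 - u j := by linarith [(hu' j).2]
    rw [← Real.mul_rpow (mob_mem hs (hu' j)).1 (by linarith [(mob_mem hs (hu' j)).2]),
      ← Real.mul_rpow h0 h1, ← Real.mul_rpow (hr j).le (mul_nonneg h0 h1), one_sub_mob hs (hu' j)]
    congr 1
    unfold mob
    have := (hD j).ne'
    field_simp
  unfold selW
  simp_rw [hpair, hone]
  have hpp := prod_pairs (fun j => (s / (1 - u j + s * u j) ^ 2) ^ ((2 : ℝ) / β))
  have hdist : ∀ A B : Fin β → Fin β → ℝ, ∏ j, ∏ k ∈ Finset.Ioi j, (A j k * B j k) =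
      (∏ j, ∏ k ∈ Finset.Ioi j, A j k) * ∏ j, ∏ k ∈ Finset.Ioi j, B j k := by
    intro A B
    simp only [Finset.prod_mul_distrib]
  rw [hdist, hpp, Finset.prod_mul_distrib (f := fun j => (s / (1 - u j + s * u j) ^ 2) ^ ((2 : ℝ) / β - 1))]
  have hfin : (∏ j, s / (1 - u j + s * u j) ^ 2) *
      (∏ j, (s / (1 - u j + s * u j) ^ 2) ^ ((2 : ℝ) / β - 1)) *
      (∏ j, ((s / (1 - u j + s * u j) ^ 2) ^ ((2 : ℝ) / β)) ^ (β - 1)) =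
      ∏ j, (s / (1 - u j + s * u j) ^ 2) ^ 2 := by
    rw [← Finset.prod_mul_distrib, ← Finset.prod_mul_distrib]
    refine Finset.prod_congr rfl fun j _ => ?_
    have hj := hr j
    generalize s / (1 - u j + s * u j) ^ 2 = r at hj
    rw [← Real.rpow_natCast, ← Real.rpow_mul hj.le, ← Real.rpow_two]
    nth_rewrite 1 [← Real.rpow_one r]
    rw [← Real.rpow_add hj, ← Real.rpow_add hj, Nat.cast_sub hβ]
    congr 1
    push_cast
    field_simp
    ring
  rw [← hfin]
  ring

lemma prod_exp_mul (β : ℕ) (θ : ℝ) (u : Fin β → ℝ) :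
    selbergF β θ u = (∏ j : Fin β, Complex.exp (Complex.I * (θ : ℂ) * (u j : ℂ))) *
      (selW β u : ℂ) := rfl

lemma key_pointwise {β : ℕ} (hβ : 0 < β) (θ : ℝ) {s : ℝ} (hs : 0 < s) {u : Fin β → ℝ}
    (hu : u ∈ unitCube β) :
    (∏ j, s / (1 - u j + s * u j) ^ 2) • selbergF β θ (fun j => mob s (u j)) =
      (∏ j, gfac θ s (u j)) * (selW β u : ℂ) := by
  have h := congrArg (fun x : ℝ => (x : ℂ)) (selW_mob hβ hs hu)
  simp only [Complex.ofReal_mul] at h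
  unfold gfac
  rw [prod_exp_mul, Complex.real_smul, Finset.prod_mul_distrib, ← Complex.ofReal_prod]
  linear_combination (∏ j : Fin β, Complex.exp (Complex.I * (θ : ℂ) * (mob s (u j) : ℂ))) * h

lemma measurableSet_unitCube (β : ℕ) : MeasurableSet (unitCube β) :=
  MeasurableSet.univ_pi fun _ => measurableSet_Icc

lemma isCompact_unitCube (β : ℕ) : IsCompact (unitCube β) :=
  isCompact_univ_pi fun _ => isCompact_Icc

lemma change_var {β : ℕ} (hβ : 0 < β) (θ : ℝ) {s : ℝ} (hs : 0 < s) :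
    ∫ u in unitCube β, (∏ j, gfac θ s (u j)) * (selW β u : ℂ) =
      ∫ u in unitCube β, selbergF β θ u := by
  have himg : (fun (u : Fin β → ℝ) j => mob s (u j)) '' unitCube β = unitCube β := by
    ext v
    constructor
    · rintro ⟨u, hu, rfl⟩ j _
      exact mob_mem hs (hu j trivial)
    · intro hv
      refine ⟨fun j => mob s⁻¹ (v j), fun j _ => mob_mem (inv_pos.2 hs) (hv j trivial), ?_⟩
      funext j
      simpa using mob_inv (inv_pos.2 hs) (hv j trivial)
  have hinj : Set.InjOn (fun (u : Fin β → ℝ) j => mob s (u j)) (unitCube β) := by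
    intro u hu v hv h
    funext j
    have := congrFun h j
    simp only at this
    rw [← mob_inv hs (hu j trivial), this, mob_inv hs (hv j trivial)]
  have hder : ∀ u ∈ unitCube β, HasFDerivWithinAt (fun (u : Fin β → ℝ) j => mob s (u j))
      (ContinuousLinearMap.pi fun j =>
        (ContinuousLinearMap.toSpanSingleton ℝ (s / (1 - u j + s * u j) ^ 2)) ∘SL
          ContinuousLinearMap.proj (R := ℝ) (φ := fun _ : Fin β => ℝ) j) (unitCube β) u := by
    intro u hu
    refine HasFDerivAt.hasFDerivWithinAt ?_
    rw [hasFDerivAt_pi]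
    intro j
    exact (hasDerivAt_mob_x hs (hu j trivial)).hasFDerivAt.comp u
      (ContinuousLinearMap.proj (R := ℝ) (φ := fun _ : Fin β => ℝ) j).hasFDerivAt
  have h := integral_image_eq_integral_abs_det_fderiv_smul volume (measurableSet_unitCube β)
    hder hinj (selbergF β θ)
  rw [himg] at h
  rw [h]
  refine setIntegral_congr_fun (measurableSet_unitCube β) fun u hu => ?_
  rw [← key_pointwise hβ θ hs hu, ContinuousLinearMap.det_pi]
  congr 1
  have hdet : ∀ a : ℝ, (ContinuousLinearMap.toSpanSingleton ℝ a).det = a := by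
    intro a
    rw [ContinuousLinearMap.det, LinearMap.det_ring]
    simp
  simp_rw [hdet]
  rw [abs_of_nonneg]
  exact Finset.prod_nonneg fun j _ => div_nonneg hs.le (sq_nonneg _)

lemma measurable_selW (β : ℕ) : Measurable (selW β) := by
  unfold selW
  fun_prop

lemma integrable_one_dim {a : ℝ} (ha : 0 < a) :
    IntegrableOn (fun x : ℝ => x ^ (a - 1) * (1 - x) ^ (a - 1)) (Set.Icc 0 1) volume := by
  have h := Complex.betaIntegral_convergent (u := (a : ℂ)) (v := (a : ℂ)) (by simpa) (by simpa)
  rw [intervalIntegrable_iff_integrableOn_Icc_of_le zero_le_one] at h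
  have h2 := h.re
  refine IntegrableOn.congr_fun h2 (fun x hx => ?_) measurableSet_Icc
  have h1 : 0 ≤ 1 - x := by linarith [hx.2]
  have e : (x : ℂ) ^ ((a : ℂ) - 1) * (1 - (x : ℂ)) ^ ((a : ℂ) - 1) =
      ((x ^ (a - 1) * (1 - x) ^ (a - 1) : ℝ) : ℂ) := by
    rw [Complex.ofReal_mul, Complex.ofReal_cpow hx.1, Complex.ofReal_cpow h1]
    push_cast
    rfl
  simp only [e]
  exact Complex.ofReal_re _

lemma integrable_selW {β : ℕ} (hβ : 0 < β) : IntegrableOn (selW β) (unitCube β) volume := by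
  have ha : (0 : ℝ) < 2 / β := by positivity
  have h1 : IntegrableOn (fun u : Fin β → ℝ =>
      ∏ j : Fin β, u j ^ ((2 : ℝ) / β - 1) * (1 - u j) ^ ((2 : ℝ) / β - 1))
      (unitCube β) volume := by
    unfold IntegrableOn unitCube
    rw [volume_pi, Measure.restrict_pi_pi]
    exact Integrable.fintype_prod
      (f := fun (_ : Fin β) (x : ℝ) => x ^ ((2 : ℝ) / β - 1) * (1 - x) ^ ((2 : ℝ) / β - 1))
      fun _ => integrable_one_dim ha
  refine Integrable.mul_bdd (c := 1) h1 ?_ ?_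
  · exact Measurable.aestronglyMeasurable (by fun_prop)
  · refine (ae_restrict_iff' (measurableSet_unitCube β)).2 (Eventually.of_forall fun u hu => ?_)
    have hnn : ∀ j k, 0 ≤ |u k - u j| ^ ((4 : ℝ) / β) := fun j k => by positivity
    rw [Real.norm_of_nonneg (Finset.prod_nonneg fun j _ => Finset.prod_nonneg fun k _ => hnn j k)]
    refine Finset.prod_le_one (fun j _ => Finset.prod_nonneg fun k _ => hnn j k) fun j _ => ?_
    refine Finset.prod_le_one (fun k _ => hnn j k) fun k _ => ?_
    refine Real.rpow_le_one (abs_nonneg _) ?_ (by positivity)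
    have hj := hu j trivial
    have hk := hu k trivial
    rw [abs_le]
    exact ⟨by linarith [hj.2, hk.1], by linarith [hj.1, hk.2]⟩

lemma integrable_cont_mul {β : ℕ} (hβ : 0 < β) {f : (Fin β → ℝ) → ℂ}
    (hf : ContinuousOn f (unitCube β)) :
    IntegrableOn (fun u => f u * (selW β u : ℂ)) (unitCube β) volume := by
  obtain ⟨C, hC⟩ := (isCompact_unitCube β).exists_bound_of_continuousOn hf
  exact Integrable.bdd_mul (c := C) (integrable_selW hβ).ofReal
    (hf.aestronglyMeasurable (measurableSet_unitCube β))
    ((ae_restrict_iff' (measurableSet_unitCube β)).2 (Eventually.of_forall hC))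

/-- The derivative of the product of the `gfac`. -/
noncomputable def Gder (β : ℕ) (θ s : ℝ) (u : Fin β → ℝ) : ℂ :=
  ∑ i : Fin β, (∏ j ∈ Finset.univ.erase i, gfac θ s (u j)) • gfac' θ s (u i)

lemma continuousOn_gfac (β : ℕ) (θ : ℝ) (j : Fin β) :
    ContinuousOn (fun p : ℝ × (Fin β → ℝ) => gfac θ p.1 (p.2 j))
      (Set.Icc (1 / 2) 2 ×ˢ unitCube β) := by
  have hD : ∀ p ∈ (Set.Icc (1 / 2 : ℝ) 2 ×ˢ unitCube β), 1 - p.2 j + p.1 * p.2 j ≠ 0 :=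
    fun p hp => (mob_den_pos (by linarith [hp.1.1]) (hp.2 j trivial)).ne'
  have hD2 : ∀ p ∈ (Set.Icc (1 / 2 : ℝ) 2 ×ˢ unitCube β), (1 - p.2 j + p.1 * p.2 j) ^ 2 ≠ 0 :=
    fun p hp => pow_ne_zero 2 (hD p hp)
  unfold gfac mob
  fun_prop (disch := assumption)

lemma continuousOn_gfac' (β : ℕ) (θ : ℝ) (j : Fin β) :
    ContinuousOn (fun p : ℝ × (Fin β → ℝ) => gfac' θ p.1 (p.2 j))
      (Set.Icc (1 / 2) 2 ×ˢ unitCube β) := by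
  have hD : ∀ p ∈ (Set.Icc (1 / 2 : ℝ) 2 ×ˢ unitCube β), 1 - p.2 j + p.1 * p.2 j ≠ 0 :=
    fun p hp => (mob_den_pos (by linarith [hp.1.1]) (hp.2 j trivial)).ne'
  have hD2 : ∀ p ∈ (Set.Icc (1 / 2 : ℝ) 2 ×ˢ unitCube β), (1 - p.2 j + p.1 * p.2 j) ^ 2 ≠ 0 :=
    fun p hp => pow_ne_zero 2 (hD p hp)
  have hD3 : ∀ p ∈ (Set.Icc (1 / 2 : ℝ) 2 ×ˢ unitCube β), (1 - p.2 j + p.1 * p.2 j) ^ 3 ≠ 0 :=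
    fun p hp => pow_ne_zero 3 (hD p hp)
  unfold gfac' mob
  fun_prop (disch := assumption)

lemma continuousOn_Gder (β : ℕ) (θ : ℝ) :
    ContinuousOn (fun p : ℝ × (Fin β → ℝ) => Gder β θ p.1 p.2)
      (Set.Icc (1 / 2) 2 ×ˢ unitCube β) := by
  unfold Gder
  simp_rw [smul_eq_mul]
  refine continuousOn_finsetSum _ fun i _ => ContinuousOn.mul ?_ (continuousOn_gfac' β θ i)
  exact continuousOn_finsetProd _ fun j _ => continuousOn_gfac β θ j

lemma Gder_one (β : ℕ) (θ : ℝ) (u : Fin β → ℝ) :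
    Gder β θ 1 u = (∏ j : Fin β, Complex.exp (Complex.I * (θ : ℂ) * (u j : ℂ))) *
      (2 * (β : ℂ) - 4 * ((∑ k : Fin β, u k : ℝ) : ℂ) +
        Complex.I * θ * ((∑ k : Fin β, u k * (1 - u k) : ℝ) : ℂ)) := by
  have h1 : ∀ x, gfac θ 1 x = Complex.exp (Complex.I * (θ : ℂ) * (x : ℂ)) := by
    intro x; simp [gfac, mob]
  have h2 : ∀ x, gfac' θ 1 x = Complex.exp (Complex.I * (θ : ℂ) * (x : ℂ)) *
      (2 - 4 * x + Complex.I * θ * (x * (1 - x))) := by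
    intro x; simp [gfac', mob]; ring
  unfold Gder
  simp_rw [h1, h2, smul_eq_mul, ← mul_assoc]
  have h3 : ∀ i : Fin β, (∏ j ∈ Finset.univ.erase i,
      Complex.exp (Complex.I * (θ : ℂ) * (u j : ℂ))) *
      Complex.exp (Complex.I * (θ : ℂ) * (u i : ℂ)) =
      ∏ j : Fin β, Complex.exp (Complex.I * (θ : ℂ) * (u j : ℂ)) :=
    fun i => Finset.prod_erase_mul _ _ (Finset.mem_univ i)
  simp_rw [h3]
  rw [← Finset.mul_sum]
  congr 1
  rw [Finset.sum_add_distrib, Finset.sum_sub_distrib]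
  push_cast
  simp only [Finset.sum_const, Finset.card_univ, Fintype.card_fin, nsmul_eq_mul,
    Finset.mul_sum, mul_assoc]
  ring

lemma integral_Gder {β : ℕ} (hβ : 0 < β) (θ : ℝ) :
    ∫ u in unitCube β, Gder β θ 1 u * (selW β u : ℂ) = 0 := by
  obtain ⟨C, hC⟩ := (isCompact_Icc.prod (isCompact_unitCube β)).exists_bound_of_continuousOn
    (continuousOn_Gder β θ)
  have hslice : ∀ s ∈ Set.Icc (1 / 2 : ℝ) 2, ∀ f : ℝ × (Fin β → ℝ) → ℂ,
      ContinuousOn f (Set.Icc (1 / 2 : ℝ) 2 ×ˢ unitCube β) →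
      ContinuousOn (fun u => f (s, u)) (unitCube β) := fun s hs f hf =>
    hf.comp (by fun_prop) fun u hu => ⟨hs, hu⟩
  have hprod : ContinuousOn (fun p : ℝ × (Fin β → ℝ) => ∏ j, gfac θ p.1 (p.2 j))
      (Set.Icc (1 / 2 : ℝ) 2 ×ˢ unitCube β) :=
    continuousOn_finsetProd _ fun j _ => continuousOn_gfac β θ j
  have h1mem : (1 : ℝ) ∈ Set.Icc (1 / 2 : ℝ) 2 := by norm_num
  have hnhds : Set.Icc (1 / 2 : ℝ) 2 ∈ 𝓝 (1 : ℝ) := Icc_mem_nhds (by norm_num) (by norm_num)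
  have hmain := hasDerivAt_integral_of_dominated_loc_of_deriv_le (𝕜 := ℝ)
    (μ := volume.restrict (unitCube β))
    (F := fun s u => (∏ j, gfac θ s (u j)) * (selW β u : ℂ))
    (F' := fun s u => Gder β θ s u * (selW β u : ℂ))
    (bound := fun u => C * ‖selW β u‖) (x₀ := 1) hnhds
    (by
      filter_upwards [hnhds] with s hs
      exact (integrable_cont_mul hβ (hslice s hs _ hprod)).aestronglyMeasurable)
    (integrable_cont_mul hβ (hslice 1 h1mem _ hprod))
    (integrable_cont_mul hβ (hslice 1 h1mem _ (continuousOn_Gder β θ))).aestronglyMeasurable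
    (by
      refine (ae_restrict_iff' (measurableSet_unitCube β)).2 (Eventually.of_forall ?_)
      intro u hu s hs
      rw [norm_mul, Complex.norm_real]
      exact mul_le_mul_of_nonneg_right (hC (s, u) ⟨hs, hu⟩) (norm_nonneg _))
    ((integrable_selW hβ).norm.const_mul C)
    (by
      refine (ae_restrict_iff' (measurableSet_unitCube β)).2 (Eventually.of_forall ?_)
      intro u hu s hs
      refine HasDerivAt.mul_const ?_ _
      exact HasDerivAt.fun_finsetProd fun i _ =>
        hasDerivAt_gfac θ (by linarith [hs.1]) (hu i trivial))
  have hconst : HasDerivAt (fun s : ℝ => ∫ u in unitCube β,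
      (∏ j, gfac θ s (u j)) * (selW β u : ℂ)) 0 1 := by
    refine (hasDerivAt_const (1 : ℝ) (∫ u in unitCube β, selbergF β θ u)).congr_of_eventuallyEq ?_
    filter_upwards [hnhds] with s hs
    exact change_var hβ θ (by linarith [hs.1])
  exact hmain.2.unique hconst

/-- The Aomoto-type integration-by-parts identity
`iθ·∫ (Σ_k u_k(1−u_k)) F(u) du = −2β·∫ F(u) du + 4·∫ (Σ_k u_k) F(u) du`,
all integrals being absolutely convergent. -/
theorem aomoto_integration_by_parts_identity (β : ℕ) (hβ : 0 < β) (hβe : Even β) (θ : ℝ) :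
    IntegrableOn (fun u => selbergF β θ u) (unitCube β) volume ∧
    IntegrableOn (fun u => ((∑ k : Fin β, u k * (1 - u k) : ℝ) : ℂ) * selbergF β θ u)
      (unitCube β) volume ∧
    IntegrableOn (fun u => ((∑ k : Fin β, u k : ℝ) : ℂ) * selbergF β θ u)
      (unitCube β) volume ∧
    Complex.I * (θ : ℂ) *
        ∫ u in unitCube β, ((∑ k : Fin β, u k * (1 - u k) : ℝ) : ℂ) * selbergF β θ u =
      -2 * (β : ℂ) * (∫ u in unitCube β, selbergF β θ u) +
        4 * ∫ u in unitCube β, ((∑ k : Fin β, u k : ℝ) : ℂ) * selbergF β θ u := by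
  have hc : ∀ {f : (Fin β → ℝ) → ℂ}, Continuous f →
      IntegrableOn (fun u => f u * selbergF β θ u) (unitCube β) volume := by
    intro f hf
    have := integrable_cont_mul hβ (f := fun u => f u *
      ∏ j : Fin β, Complex.exp (Complex.I * (θ : ℂ) * (u j : ℂ))) (by fun_prop)
    simp_rw [prod_exp_mul, ← mul_assoc]
    exact this
  have i0 : IntegrableOn (fun u => selbergF β θ u) (unitCube β) volume := by
    simpa using hc (f := fun _ => 1) continuous_const
  have i1 : IntegrableOn (fun u => ((∑ k : Fin β, u k * (1 - u k) : ℝ) : ℂ) * selbergF β θ u)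
      (unitCube β) volume := hc (by fun_prop)
  have i2 : IntegrableOn (fun u => ((∑ k : Fin β, u k : ℝ) : ℂ) * selbergF β θ u)
      (unitCube β) volume := hc (by fun_prop)
  refine ⟨i0, i1, i2, ?_⟩
  have h := integral_Gder hβ θ
  have e : ∀ u : Fin β → ℝ, Gder β θ 1 u * (selW β u : ℂ) =
      (2 * (β : ℂ)) * selbergF β θ u - 4 * (((∑ k : Fin β, u k : ℝ) : ℂ) * selbergF β θ u) +
      (Complex.I * θ) * (((∑ k : Fin β, u k * (1 - u k) : ℝ) : ℂ) * selbergF β θ u) := by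
    intro u
    rw [Gder_one, prod_exp_mul]
    ring
  simp_rw [e] at h
  rw [integral_add (by exact (i0.const_mul _).sub (i2.const_mul _)) (i1.const_mul _),
    integral_sub (i0.const_mul _) (i2.const_mul _), integral_const_mul, integral_const_mul,
    integral_const_mul] at h
  linear_combination h
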